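/- arXiv:1703.06821 — 3 statements merged into one kernel-verified Lean document; each statement's English description precedes it below -/
import Mathlib

section
/- Let K be a field, V = K^7, and χ := [152] + [174] + [163] + [243]. Let A := {u ∈ V : u_1 = u_2 = u_3 = u_4 = 0}. Then: (i) a nonzero u ∈ V is a pole of χ if and only if u_1 = 0; (ii) dim Rad_χ(u) = 5 if and only if u is a nonzero element of A; (iii) a 2-dimensional subspace ℓ of V lies in the upper radical R↑(χ) if and only if ℓ ⊆ {u : u_1 = 0}, ℓ ∩ A ≠ 0, and x_2·y_5 − x_5·y_2 + x_3·y_6 − x_6·y_3 + x_4·y_7 − x_7·y_4 = 0 for all x, y ∈ ℓ. -/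
open Module

/-- The radical of a point `u` with respect to an alternating trilinear form `χ` on `V`:
the subspace `Rad_χ(u) = {v ∈ V | χ(u, v, x) = 0 for all x ∈ V}`. -/
def trilinRad {K V : Type*} [Field K] [AddCommGroup V] [Module K V]
    (χ : AlternatingMap K V K (Fin 3)) (u : V) : Submodule K V where
  carrier := {v | ∀ x : V, χ ![u, v, x] = 0}
  add_mem' := by
    intro a b ha hb x
    have h1 : (![u, a + b, x] : Fin 3 → V) = Function.update ![u, a, x] 1 (a + b) := by
      funext i; fin_cases i <;> simp
    have h2 : Function.update (![u, a, x] : Fin 3 → V) 1 a = ![u, a, x] := by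
      funext i; fin_cases i <;> simp
    have h3 : Function.update (![u, a, x] : Fin 3 → V) 1 b = ![u, b, x] := by
      funext i; fin_cases i <;> simp
    calc χ ![u, a + b, x]
        = χ (Function.update ![u, a, x] 1 (a + b)) := by rw [h1]
      _ = χ (Function.update ![u, a, x] 1 a) + χ (Function.update ![u, a, x] 1 b) := by
          rw [AlternatingMap.map_update_add]
      _ = 0 := by rw [h2, h3, ha x, hb x, add_zero]
  zero_mem' := by
    intro x
    exact AlternatingMap.map_coord_zero χ 1 (by simp)
  smul_mem' := by
    intro c a ha x
    have h1 : (![u, c • a, x] : Fin 3 → V) = Function.update ![u, a, x] 1 (c • a) := by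
      funext i; fin_cases i <;> simp
    have h2 : Function.update (![u, a, x] : Fin 3 → V) 1 a = ![u, a, x] := by
      funext i; fin_cases i <;> simp
    rw [h1, AlternatingMap.map_update_smul, h2, ha x, smul_zero]

/-- The basic alternating trilinear form `[ijk]` on `K^n`, sending `(x, y, z)` to the
determinant of the 3×3 matrix with rows `(x i, x j, x k)`, `(y i, y j, y k)`,
`(z i, z j, z k)`.  (Indices are 0-based: the form written `[123]` in the paper is
`trip 0 1 2`.) -/
noncomputable def trip {K : Type*} [Field K] {n : ℕ} (i j k : Fin n) :
    AlternatingMap K (Fin n → K) K (Fin 3) :=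
  (Matrix.detRowAlternating : AlternatingMap K (Fin 3 → K) K (Fin 3)).compLinearMap
    (LinearMap.funLeft K K ![i, j, k])

namespace TrilinearSeven

variable {K : Type*} [Field K]

theorem trip_apply {n : ℕ} (i j k : Fin n) (x y z : Fin n → K) :
    trip i j k ![x, y, z] =
      x i * y j * z k - x i * y k * z j - x j * y i * z k + x j * y k * z i
        + x k * y i * z j - x k * y j * z i := by
  change (Matrix.of fun r s => (![x, y, z] : Fin 3 → Fin n → K) r (![i, j, k] s)).det = _
  simp [Matrix.det_fin_three]

variable (K) in
/-- The form `[152] + [174] + [163] + [243]` on `K^7`. -/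
noncomputable def form : AlternatingMap K (Fin 7 → K) K (Fin 3) :=
  trip 0 4 1 + trip 0 6 3 + trip 0 5 2 + trip 1 3 2

theorem form_apply (u x y : Fin 7 → K) :
    form K ![u, x, y] =
      u 0 * (x 4 * y 1 - x 1 * y 4 + x 5 * y 2 - x 2 * y 5 + x 6 * y 3 - x 3 * y 6)
      + u 1 * (x 0 * y 4 - x 4 * y 0 - (x 2 * y 3 - x 3 * y 2))
      + u 2 * (x 0 * y 5 - x 5 * y 0 - (x 3 * y 1 - x 1 * y 3))
      + u 3 * (x 0 * y 6 - x 6 * y 0 - (x 1 * y 2 - x 2 * y 1))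
      + u 4 * (x 1 * y 0 - x 0 * y 1)
      + u 5 * (x 2 * y 0 - x 0 * y 2)
      + u 6 * (x 3 * y 0 - x 0 * y 3) := by
  simp only [form, AlternatingMap.add_apply, trip_apply]
  ring

/-- The coordinates of the covector `form K ![·, x, y]` all vanish. -/
structure CoordVanish (x y : Fin 7 → K) : Prop where
  e0 : x 4 * y 1 - x 1 * y 4 + x 5 * y 2 - x 2 * y 5 + x 6 * y 3 - x 3 * y 6 = 0
  e1 : x 0 * y 4 - x 4 * y 0 - (x 2 * y 3 - x 3 * y 2) = 0
  e2 : x 0 * y 5 - x 5 * y 0 - (x 3 * y 1 - x 1 * y 3) = 0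
  e3 : x 0 * y 6 - x 6 * y 0 - (x 1 * y 2 - x 2 * y 1) = 0
  e4 : x 1 * y 0 - x 0 * y 1 = 0
  e5 : x 2 * y 0 - x 0 * y 2 = 0
  e6 : x 3 * y 0 - x 0 * y 3 = 0

theorem forall_form_eq_zero_iff (x y : Fin 7 → K) :
    (∀ u, form K ![u, x, y] = 0) ↔ CoordVanish x y := by
  constructor
  · intro h
    have key (i : Fin 7) := h (Pi.single i 1)
    simp only [form_apply] at key
    constructor
    · simpa using key 0
    · simpa using key 1
    · simpa using key 2
    · simpa using key 3
    · simpa using key 4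
    · simpa using key 5
    · simpa using key 6
  · rintro ⟨h0, h1, h2, h3, h4, h5, h6⟩ u
    rw [form_apply, h0, h1, h2, h3, h4, h5, h6]
    ring

theorem mem_trilinRad_iff (u v : Fin 7 → K) :
    v ∈ trilinRad (form K) u ↔ CoordVanish u v := by
  rw [← forall_form_eq_zero_iff]
  refine forall_congr' fun x => ?_
  have : form K ![u, v, x] = form K ![x, u, v] := by
    simp only [form_apply]
    ring
  change form K ![u, v, x] = 0 ↔ _
  rw [this]

theorem finrank_rad_le_one {u : Fin 7 → K} (hu : u 0 ≠ 0) :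
    finrank K (trilinRad (form K) u) ≤ 1 := by
  refine (Submodule.finrank_mono (t := K ∙ u) fun v hv => ?_).trans
    ((finrank_span_le_card ({u} : Set (Fin 7 → K))).trans_eq (by simp))
  obtain ⟨h0, h1, h2, h3, h4, h5, h6⟩ := (mem_trilinRad_iff u v).1 hv
  refine Submodule.mem_span_singleton.2 ⟨v 0 / u 0, ?_⟩
  have a1 : u 0 * v 1 = v 0 * u 1 := by linear_combination -h4
  have a2 : u 0 * v 2 = v 0 * u 2 := by linear_combination -h5
  have a3 : u 0 * v 3 = v 0 * u 3 := by linear_combination -h6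
  have a4 : u 0 * v 4 = v 0 * u 4 := mul_left_cancel₀ hu (by
    linear_combination u 0 * h1 + u 2 * a3 - u 3 * a2)
  have a5 : u 0 * v 5 = v 0 * u 5 := mul_left_cancel₀ hu (by
    linear_combination u 0 * h2 + u 3 * a1 - u 1 * a3)
  have a6 : u 0 * v 6 = v 0 * u 6 := mul_left_cancel₀ hu (by
    linear_combination u 0 * h3 + u 1 * a2 - u 2 * a1)
  funext i
  rw [Pi.smul_apply, smul_eq_mul, div_mul_eq_mul_div, div_eq_iff hu]
  fin_cases i <;> simp only [Fin.reduceFinMk, Fin.zero_eta, Fin.mk_one, Fin.isValue] <;> grind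

theorem two_le_finrank_rad {u : Fin 7 → K} (hu : u 0 = 0) :
    2 ≤ finrank K (trilinRad (form K) u) := by
  let f : (Fin 3 → K) →ₗ[K] K := Fintype.linearCombination K ![u 1, u 2, u 3]
  let g : (Fin 3 → K) →ₗ[K] (Fin 7 → K) :=
    LinearMap.pi ![0, 0, 0, 0, LinearMap.proj 0, LinearMap.proj 1, LinearMap.proj 2]
  have hg : Function.Injective g := by
    intro c d h
    funext i
    fin_cases i
    · exact congrFun h 4
    · exact congrFun h 5
    · exact congrFun h 6
  have hle : (LinearMap.ker f).map g ≤ trilinRad (form K) u := by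
    rintro _ ⟨c, hc, rfl⟩
    have hc : c 0 * u 1 + c 1 * u 2 + c 2 * u 3 = 0 := by
      simpa [f, Fintype.linearCombination_apply, Fin.sum_univ_three] using hc
    refine (mem_trilinRad_iff _ _).2 ?_
    constructor <;> simp [g, hu]
    linear_combination -hc
  have hrank := f.finrank_range_add_finrank_ker
  have hrange := (LinearMap.range f).finrank_le
  have := Submodule.finrank_mono hle
  rw [(Submodule.equivMapOfInjective g hg _).symm.finrank_eq] at this
  simp only [finrank_fin_fun, finrank_self] at hrank hrange
  omega

theorem cross_eq_zero_of_coordVanish {x y : Fin 7 → K} (h : CoordVanish x y)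
    (hx : x 0 = 0) (hy : y 0 = 0) :
    x 2 * y 3 = x 3 * y 2 ∧ x 3 * y 1 = x 1 * y 3 ∧ x 1 * y 2 = x 2 * y 1 := by
  obtain ⟨-, h1, h2, h3, -, -, -⟩ := h
  grind

/-- If `x` is nonzero at one of the coordinates `1, 2, 3`, then a `y` that vanishes at this
coordinate and is parallel to `x` along these coordinates vanishes at all three. -/
theorem exists_pivot {x : Fin 7 → K} (hx : ¬ (x 1 = 0 ∧ x 2 = 0 ∧ x 3 = 0)) :
    ∃ i, ∀ y : Fin 7 → K, y i = 0 →
      x 2 * y 3 = x 3 * y 2 ∧ x 3 * y 1 = x 1 * y 3 ∧ x 1 * y 2 = x 2 * y 1 →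
      y 1 = 0 ∧ y 2 = 0 ∧ y 3 = 0 := by
  by_cases h1 : x 1 = 0
  · by_cases h2 : x 2 = 0
    · exact ⟨3, by grind⟩
    · exact ⟨2, by grind⟩
  · exact ⟨1, by grind⟩

theorem finrank_rad_le_four {u : Fin 7 → K} (hu0 : u 0 = 0)
    (hu : ¬ (u 1 = 0 ∧ u 2 = 0 ∧ u 3 = 0)) :
    finrank K (trilinRad (form K) u) ≤ 4 := by
  obtain ⟨i, hi⟩ := exists_pivot hu
  let f := LinearMap.funLeft K K ![i, 4, 5, 6] ∘ₗ (trilinRad (form K) u).subtype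
  have hf : Function.Injective f := by
    rw [← LinearMap.ker_eq_bot, LinearMap.ker_eq_bot']
    rintro ⟨v, hv⟩ hfv
    have hvan := (mem_trilinRad_iff u v).1 hv
    have hv0 : v 0 = 0 := by
      obtain ⟨-, -, -, -, h4, h5, h6⟩ := hvan
      grind
    have hvi : v i = 0 := congrFun hfv 0
    have hv4 : v 4 = 0 := congrFun hfv 1
    have hv5 : v 5 = 0 := congrFun hfv 2
    have hv6 : v 6 = 0 := congrFun hfv 3
    obtain ⟨hv1, hv2, hv3⟩ := hi v hvi (cross_eq_zero_of_coordVanish hvan hu0 hv0)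
    ext j
    fin_cases j <;> assumption
  simpa using LinearMap.finrank_le_finrank_of_injective hf

theorem finrank_rad_eq_five {u : Fin 7 → K} (hu : u ≠ 0) (h0 : u 0 = 0) (h1 : u 1 = 0)
    (h2 : u 2 = 0) (h3 : u 3 = 0) :
    finrank K (trilinRad (form K) u) = 5 := by
  let f : (Fin 7 → K) →ₗ[K] K × K := (LinearMap.proj 0).prod
    (u 4 • LinearMap.proj 1 + u 5 • LinearMap.proj 2 + u 6 • LinearMap.proj 3)
  have hf (v) : f v = (v 0, u 4 * v 1 + u 5 * v 2 + u 6 * v 3) := rfl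
  have hpiv : u 4 ≠ 0 ∨ u 5 ≠ 0 ∨ u 6 ≠ 0 := by
    by_contra! h
    refine hu (funext fun i => ?_)
    fin_cases i <;> simp_all
  have hsurj : Function.Surjective f := by
    rintro ⟨s, t⟩
    rcases hpiv with h | h | h
    · exact ⟨![s, t / u 4, 0, 0, 0, 0, 0], by simp [hf, mul_div_cancel₀, h]⟩
    · exact ⟨![s, 0, t / u 5, 0, 0, 0, 0], by simp [hf, mul_div_cancel₀, h]⟩
    · exact ⟨![s, 0, 0, t / u 6, 0, 0, 0], by simp [hf, mul_div_cancel₀, h]⟩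
  have hker : trilinRad (form K) u = LinearMap.ker f := by
    ext v
    rw [mem_trilinRad_iff, LinearMap.mem_ker, hf, Prod.mk_eq_zero]
    constructor
    · rintro ⟨e0, e1, e2, e3, -, -, -⟩
      constructor <;> grind
    · rintro ⟨hv, hv'⟩
      constructor <;> grind
  have := f.finrank_range_add_finrank_ker
  rw [LinearMap.range_eq_top.2 hsurj, finrank_top] at this
  simp only [finrank_prod, finrank_self, finrank_fin_fun] at this
  rw [hker]
  omega

theorem finrank_rad_eq_five_iff (u : Fin 7 → K) :
    finrank K (trilinRad (form K) u) = 5 ↔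
      (u ≠ 0 ∧ u 0 = 0 ∧ u 1 = 0 ∧ u 2 = 0 ∧ u 3 = 0) := by
  refine ⟨fun h => ?_, fun ⟨hu, h0, h1, h2, h3⟩ => finrank_rad_eq_five hu h0 h1 h2 h3⟩
  have h0 : u 0 = 0 := by
    by_contra hu
    have := finrank_rad_le_one hu
    omega
  refine ⟨?_, h0, ?_⟩
  · rintro rfl
    have htop : trilinRad (form K) (0 : Fin 7 → K) = ⊤ :=
      eq_top_iff.2 fun v _ => (mem_trilinRad_iff _ _).2 (by constructor <;> simp)
    rw [htop, finrank_top, finrank_fin_fun] at h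
    omega
  · by_contra hu
    have := finrank_rad_le_four h0 hu
    omega

theorem exists_ne_zero_mem_apply_eq_zero {ι : Type*} [Finite ι] {ℓ : Submodule K (ι → K)}
    (hℓ : finrank K ℓ = 2) (i : ι) : ∃ z ∈ ℓ, z ≠ 0 ∧ z i = 0 := by
  have hker := LinearMap.ker_ne_bot_of_finrank_lt
    (f := LinearMap.proj (R := K) (φ := fun _ : ι => K) i ∘ₗ ℓ.subtype)
    (by rw [hℓ, finrank_self]; norm_num)
  obtain ⟨z, hz, hz0⟩ := Submodule.exists_mem_ne_zero_of_ne_bot hker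
  exact ⟨z, z.2, by simpa using hz0, hz⟩

/-- Two vectors of a plane are dependent modulo any nonzero vector of the plane. -/
theorem exists_smul_add_smul_eq_smul {V : Type*} [AddCommGroup V] [Module K V]
    {ℓ : Submodule K V} (hℓ : finrank K ℓ = 2) {x y z : V} (hx : x ∈ ℓ) (hy : y ∈ ℓ)
    (hz : z ∈ ℓ) (hz0 : z ≠ 0) :
    ∃ a b c : K, (a ≠ 0 ∨ b ≠ 0) ∧ a • x + b • y = c • z := by
  have : FiniteDimensional K ℓ := FiniteDimensional.of_finrank_pos (by omega)
  have hker := LinearMap.ker_ne_bot_of_finrank_lt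
    (f := Fintype.linearCombination K (![⟨x, hx⟩, ⟨y, hy⟩, ⟨z, hz⟩] : Fin 3 → ℓ))
    (by rw [hℓ, finrank_fin_fun]; norm_num)
  obtain ⟨t, ht, ht0⟩ := Submodule.exists_mem_ne_zero_of_ne_bot hker
  have hsum : t 0 • x + t 1 • y + t 2 • z = 0 := by
    simpa [Fintype.linearCombination_apply, Fin.sum_univ_three] using congrArg Subtype.val ht
  refine ⟨t 0, t 1, -t 2, ?_, by rw [neg_smul, eq_neg_iff_add_eq_zero, hsum]⟩
  by_contra! h
  have h2 : t 2 = 0 := by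
    simpa [h.1, h.2, hz0] using hsum
  refine ht0 (funext fun i => ?_)
  fin_cases i
  · exact h.1
  · exact h.2
  · exact h2

theorem upperRadical_iff {ℓ : Submodule K (Fin 7 → K)} (hℓ : finrank K ℓ = 2) :
    (∀ u : Fin 7 → K, ∀ x ∈ ℓ, ∀ y ∈ ℓ, form K ![u, x, y] = 0) ↔
      ((∀ x ∈ ℓ, x 0 = 0) ∧
        (∃ x ∈ ℓ, x ≠ 0 ∧ x 0 = 0 ∧ x 1 = 0 ∧ x 2 = 0 ∧ x 3 = 0) ∧
        (∀ x ∈ ℓ, ∀ y ∈ ℓ,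
          x 1 * y 4 - x 4 * y 1 + x 2 * y 5 - x 5 * y 2 + x 3 * y 6 - x 6 * y 3 = 0)) := by
  constructor
  · intro h
    have hvan : ∀ x ∈ ℓ, ∀ y ∈ ℓ, CoordVanish x y := fun x hx y hy =>
      (forall_form_eq_zero_iff x y).1 fun u => h u x hx y hy
    have hzero : ∀ x ∈ ℓ, x 0 = 0 := by
      intro x hx
      by_contra hx0
      have hle : ℓ ≤ trilinRad (form K) x := fun y hy =>
        (mem_trilinRad_iff x y).2 (hvan x hx y hy)
      have := Submodule.finrank_mono hle
      have := finrank_rad_le_one hx0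
      omega
    refine ⟨hzero, ?_, fun x hx y hy => by linear_combination -(hvan x hx y hy).e0⟩
    by_cases hall : ∀ x ∈ ℓ, x 1 = 0 ∧ x 2 = 0 ∧ x 3 = 0
    · obtain ⟨z, hz, hz0, -⟩ := exists_ne_zero_mem_apply_eq_zero hℓ 0
      exact ⟨z, hz, hz0, hzero z hz, hall z hz⟩
    · push Not at hall
      obtain ⟨x, hx, hx'⟩ := hall
      obtain ⟨i, hi⟩ := exists_pivot (x := x) (by tauto)
      obtain ⟨z, hz, hz0, hzi⟩ := exists_ne_zero_mem_apply_eq_zero hℓ i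
      exact ⟨z, hz, hz0, hzero z hz, hi z hzi
        (cross_eq_zero_of_coordVanish (hvan x hx z hz) (hzero x hx) (hzero z hz))⟩
  · rintro ⟨hzero, ⟨z, hz, hz0, -, hz1, hz2, hz3⟩, hsymp⟩ u x hx y hy
    refine (forall_form_eq_zero_iff x y).2 ?_ u
    obtain ⟨a, b, c, hab, habc⟩ := exists_smul_add_smul_eq_smul hℓ hx hy hz hz0
    have hx0 := hzero x hx
    have hy0 := hzero y hy
    have d1 : a * x 1 + b * y 1 = 0 := by simpa [hz1] using congrFun habc 1
    have d2 : a * x 2 + b * y 2 = 0 := by simpa [hz2] using congrFun habc 2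
    have d3 : a * x 3 + b * y 3 = 0 := by simpa [hz3] using congrFun habc 3
    have minor {p q r s : K} (h : a * p + b * r = 0) (h' : a * q + b * s = 0) :
        p * s - q * r = 0 := by
      rcases hab with ha | hb
      · exact (mul_eq_zero.1 (by linear_combination s * h - r * h' :
          a * (p * s - q * r) = 0)).resolve_left ha
      · exact (mul_eq_zero.1 (by linear_combination p * h' - q * h :
          b * (p * s - q * r) = 0)).resolve_left hb
    constructor
    · linear_combination -hsymp x hx y hy
    · simp [hx0, hy0, minor d2 d3]
    · simp [hx0, hy0, minor d3 d1]
    · simp [hx0, hy0, minor d1 d2]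
    all_goals simp [hx0, hy0]

end TrilinearSeven

open TrilinearSeven

/-- for `χ = [152] + [174] + [163] + [243]` on `K^7`, with
`A = {u | u₁ = u₂ = u₃ = u₄ = 0}`:
(i) a nonzero `u` is a pole iff `u₁ = 0`;
(ii) `dim Rad_χ(u) = 5` iff `u` is a nonzero element of `A`;
(iii) a 2-dimensional subspace `ℓ` is in the upper radical iff it lies in `{u₁ = 0}`,
meets `A` nontrivially and is totally isotropic for
`x₂y₅ − x₅y₂ + x₃y₆ − x₆y₃ + x₄y₇ − x₇y₄`. -/
theorem stmt16 (K : Type*) [Field K]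
    (χ : AlternatingMap K (Fin 7 → K) K (Fin 3))
    (hχ : χ = trip 0 4 1 + trip 0 6 3 + trip 0 5 2 + trip 1 3 2) :
    (∀ u : Fin 7 → K, u ≠ 0 →
      (2 ≤ Module.finrank K (trilinRad χ u) ↔ u 0 = 0)) ∧
    (∀ u : Fin 7 → K,
      (Module.finrank K (trilinRad χ u) = 5 ↔
        (u ≠ 0 ∧ u 0 = 0 ∧ u 1 = 0 ∧ u 2 = 0 ∧ u 3 = 0))) ∧
    (∀ ℓ : Submodule K (Fin 7 → K), Module.finrank K ℓ = 2 →
      ((∀ u : Fin 7 → K, ∀ x ∈ ℓ, ∀ y ∈ ℓ, χ ![u, x, y] = 0) ↔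
        ((∀ x ∈ ℓ, x 0 = 0) ∧
          (∃ x ∈ ℓ, x ≠ 0 ∧ x 0 = 0 ∧ x 1 = 0 ∧ x 2 = 0 ∧ x 3 = 0) ∧
          (∀ x ∈ ℓ, ∀ y ∈ ℓ,
            x 1 * y 4 - x 4 * y 1 + x 2 * y 5 - x 5 * y 2 + x 3 * y 6 - x 6 * y 3 = 0)))) := by
  obtain rfl : χ = form K := hχ
  refine ⟨fun u _ => ⟨fun h => ?_, two_le_finrank_rad⟩, finrank_rad_eq_five_iff,
    fun ℓ hℓ => upperRadical_iff hℓ⟩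
  by_contra hu
  have := finrank_rad_le_one hu
  omega
end

section
/- Let K be a field, V = K^7, and χ := [146] + [157] + [245] + [367]. Then: (i) a nonzero u ∈ V is a pole of χ if and only if u_5·u_7 + u_4·u_6 = 0 (so the set of poles is the cone with vertex the plane A := {u : u_4 = u_5 = u_6 = u_7 = 0} over a hyperbolic quadric); (ii) dim Rad_χ(u) = 5 if and only if u ≠ 0, u_4 = u_5 = u_6 = u_7 = 0 and u_1² − u_2·u_3 = 0. -/
open Module

section Finrank

variable {K V : Type*} [Field K] [AddCommGroup V] [Module K V]

lemma two_le_finrank_of_not_smul [FiniteDimensional K V] {S : Submodule K V} {u w : V}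
    (hu : u ∈ S) (hw : w ∈ S) (hu0 : u ≠ 0) (h : ∀ c : K, c • u ≠ w) : 2 ≤ finrank K S := by
  have hli : LinearIndependent K ![(⟨u, hu⟩ : S), ⟨w, hw⟩] := by
    rw [LinearIndependent.pair_iff' (by simpa [Subtype.ext_iff] using hu0)]
    intro c hc
    exact h c (by simpa [Subtype.ext_iff] using hc)
  simpa using hli.fintype_card_le_finrank

lemma finrank_le_one_of_mul_eq {n : ℕ} {S : Submodule K (Fin n → K)} {u : Fin n → K}
    (hu : u ∈ S) {d : K} (hd : d ≠ 0) (l : (Fin n → K) → K)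
    (h : ∀ v ∈ S, ∀ i, d * v i = l v * u i) : finrank K S ≤ 1 := by
  refine finrank_le_one (⟨u, hu⟩ : S) fun w => ⟨l w / d, ?_⟩
  ext i
  have := h w w.2 i
  simp only [SetLike.mk_smul_mk, Pi.smul_apply, smul_eq_mul]
  field_simp
  exact this.symm

lemma finrank_le_of_coord {m n : ℕ} {S : Submodule K (Fin n → K)} (σ : Fin m → Fin n)
    (h : ∀ v ∈ S, (∀ i, v (σ i) = 0) → v = 0) : finrank K S ≤ m := by
  have hinj : Function.Injective ((LinearMap.funLeft K K σ).comp S.subtype) := by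
    rw [injective_iff_map_eq_zero]
    intro v hv
    exact Subtype.ext (h v v.2 fun i => congrFun hv i)
  simpa using LinearMap.finrank_le_finrank_of_injective hinj

lemma finrank_add_eq_of_surjective {m n : ℕ} {S : Submodule K (Fin n → K)}
    (f : (Fin n → K) →ₗ[K] (Fin m → K)) (hf : Function.Surjective f)
    (hS : ∀ v, v ∈ S ↔ f v = 0) : m + finrank K S = n := by
  have hker : S = LinearMap.ker f := by
    ext v
    simp [hS]
  have h := f.finrank_range_add_finrank_ker
  rw [LinearMap.range_eq_top.2 hf, finrank_top] at h
  rw [hker]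
  simpa using h

end Finrank

section Form

variable {K : Type*} [Field K]

lemma trip_apply {n : ℕ} (i j k : Fin n) (x y z : Fin n → K) :
    trip i j k ![x, y, z] =
      x i * (y j * z k - y k * z j) - x j * (y i * z k - y k * z i)
        + x k * (y i * z j - y j * z i) := by
  change Matrix.det (Matrix.of fun a b => (![x, y, z] : Fin 3 → Fin n → K) a (![i, j, k] b)) = _
  rw [Matrix.det_fin_three]
  simp
  ring

lemma mem_trilinRad_iff {χ : AlternatingMap K (Fin 7 → K) K (Fin 3)}
    (hχ : χ = trip 0 3 5 + trip 0 4 6 + trip 1 3 4 + trip 2 5 6) (u v : Fin 7 → K) :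
    v ∈ trilinRad χ u ↔
      u 3 * v 5 + u 4 * v 6 = u 5 * v 3 + u 6 * v 4 ∧
      u 3 * v 4 = u 4 * v 3 ∧
      u 5 * v 6 = u 6 * v 5 ∧
      u 5 * v 0 + u 4 * v 1 = u 1 * v 4 + u 0 * v 5 ∧
      u 6 * v 0 + u 1 * v 3 = u 3 * v 1 + u 0 * v 6 ∧
      u 6 * v 2 + u 0 * v 3 = u 3 * v 0 + u 2 * v 6 ∧
      u 0 * v 4 + u 2 * v 5 = u 4 * v 0 + u 5 * v 2 := by
  change (∀ x, χ ![u, v, x] = 0) ↔ _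
  simp only [hχ, AlternatingMap.add_apply, trip_apply]
  constructor
  · intro h
    have e (k : Fin 7) := h (Pi.single k 1)
    have e0 := e 0
    have e1 := e 1
    have e2 := e 2
    have e3 := e 3
    have e4 := e 4
    have e5 := e 5
    have e6 := e 6
    simp at e0 e1 e2 e3 e4 e5 e6
    refine ⟨?_, ?_, ?_, ?_, ?_, ?_, ?_⟩
    · linear_combination e0
    · linear_combination e1
    · linear_combination e2
    · linear_combination e3
    · linear_combination e4
    · linear_combination e5
    · linear_combination e6
  · rintro ⟨e0, e1, e2, e3, e4, e5, e6⟩ x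
    linear_combination x 0 * e0 + x 1 * e1 + x 2 * e2 + x 3 * e3 + x 4 * e4 + x 5 * e5 + x 6 * e6

lemma self_mem_trilinRad {χ : AlternatingMap K (Fin 7 → K) K (Fin 3)} (u : Fin 7 → K) :
    u ∈ trilinRad χ u :=
  fun _ => χ.map_eq_zero_of_eq _ (i := 0) (j := 1) rfl (by decide)

variable {χ : AlternatingMap K (Fin 7 → K) K (Fin 3)}

lemma finrank_trilinRad_le_one (hχ : χ = trip 0 3 5 + trip 0 4 6 + trip 1 3 4 + trip 2 5 6)
    {u : Fin 7 → K} (hd : u 4 * u 6 + u 3 * u 5 ≠ 0) : finrank K (trilinRad χ u) ≤ 1 := by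
  refine finrank_le_one_of_mul_eq (self_mem_trilinRad u) hd
    (fun v => u 5 * v 3 + u 6 * v 4) fun v hv i => ?_
  obtain ⟨e0, e1, e2, e3, e4, e5, e6⟩ := (mem_trilinRad_iff hχ u v).1 hv
  fin_cases i <;> simp <;> grind

lemma two_le_finrank_trilinRad (hχ : χ = trip 0 3 5 + trip 0 4 6 + trip 1 3 4 + trip 2 5 6)
    {u : Fin 7 → K} (hu : u ≠ 0) (hd : u 4 * u 6 + u 3 * u 5 = 0) :
    2 ≤ finrank K (trilinRad χ u) := by
  suffices ∃ w ∈ trilinRad χ u, ∀ c : K, c • u ≠ w by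
    obtain ⟨w, hw, h⟩ := this
    exact two_le_finrank_of_not_smul (self_mem_trilinRad u) hw hu h
  have key (x y z : K) (h : ∀ c : K, c • u ≠ ![x, y, z, 0, 0, 0, 0])
      (h3 : u 5 * x + u 4 * y = 0) (h4 : u 6 * x = u 3 * y) (h5 : u 6 * z = u 3 * x)
      (h6 : u 4 * x + u 5 * z = 0) : ∃ w ∈ trilinRad χ u, ∀ c : K, c • u ≠ w :=
    ⟨_, (mem_trilinRad_iff hχ u _).2 (by simp [h3, h4, h5, h6]), h⟩
  by_cases htop : u 3 = 0 ∧ u 4 = 0 ∧ u 5 = 0 ∧ u 6 = 0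
  · obtain ⟨hp, hq, hr, hs⟩ := htop
    by_cases ha : u 0 = 0
    · refine key 1 0 0 (fun c hc => ?_) ?_ ?_ ?_ ?_
      · simpa [ha] using congrFun hc 0
      all_goals simp [*]
    · refine key 0 1 0 (fun c hc => ?_) ?_ ?_ ?_ ?_
      · have h0 := congrFun hc 0
        have h1 := congrFun hc 1
        simp [ha] at h0
        simp [h0] at h1
      all_goals simp [*]
  have hne (x y z : K) (hxyz : x ≠ 0 ∨ y ≠ 0 ∨ z ≠ 0) (c : K) :
      c • u ≠ ![x, y, z, 0, 0, 0, 0] := by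
    intro hc
    have e (k : Fin 7) := congrFun hc k
    have e0 := e 0
    have e1 := e 1
    have e2 := e 2
    have e3 := e 3
    have e4 := e 4
    have e5 := e 5
    have e6 := e 6
    simp at e0 e1 e2 e3 e4 e5 e6
    grind
  by_cases hps : u 3 = 0 ∧ u 6 = 0
  · refine key (-(u 4 * u 5)) (u 5 ^ 2) (u 4 ^ 2) (hne _ _ _ ?_) ?_ ?_ ?_ ?_ <;> grind
  · refine key (u 3 * u 6) (u 6 ^ 2) (u 3 ^ 2) (hne _ _ _ ?_) ?_ ?_ ?_ ?_ <;> grind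

lemma finrank_trilinRad_le_four (hχ : χ = trip 0 3 5 + trip 0 4 6 + trip 1 3 4 + trip 2 5 6)
    {u : Fin 7 → K}
    (h : u 3 ≠ 0 ∨ u 4 ≠ 0 ∨ u 5 ≠ 0 ∨ u 6 ≠ 0 ∨ u 0 ^ 2 - u 1 * u 2 ≠ 0) :
    finrank K (trilinRad χ u) ≤ 4 := by
  have key (σ : Fin 4 → Fin 7)
      (hσ : ∀ v ∈ trilinRad χ u, (∀ i, v (σ i) = 0) → ∀ i, v i = 0) :
      finrank K (trilinRad χ u) ≤ 4 :=
    finrank_le_of_coord σ fun v hv h0 => funext (hσ v hv h0)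
  by_cases hp : u 3 = 0
  on_goal 2 => refine key ![1, 2, 3, 6] fun v hv h0 => ?_
  on_goal 1 => by_cases hq : u 4 = 0
  on_goal 2 => refine key ![1, 2, 4, 5] fun v hv h0 => ?_
  on_goal 1 => by_cases hr : u 5 = 0
  on_goal 2 => refine key ![1, 2, 4, 5] fun v hv h0 => ?_
  on_goal 1 => by_cases hs : u 6 = 0
  on_goal 2 => refine key ![1, 2, 3, 6] fun v hv h0 => ?_
  on_goal 1 => refine key ![0, 1, 2, 2] fun v hv h0 => ?_
  all_goals
    obtain ⟨e0, e1, e2, e3, e4, e5, e6⟩ := (mem_trilinRad_iff hχ u v).1 hv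
    simp [Fin.forall_fin_succ] at h0
    intro i
    fin_cases i <;> simp <;> grind

lemma finrank_trilinRad_eq_five (hχ : χ = trip 0 3 5 + trip 0 4 6 + trip 1 3 4 + trip 2 5 6)
    {u : Fin 7 → K} (hu : u ≠ 0) (hp : u 3 = 0) (hq : u 4 = 0) (hr : u 5 = 0) (hs : u 6 = 0)
    (hd : u 0 ^ 2 - u 1 * u 2 = 0) : finrank K (trilinRad χ u) = 5 := by
  suffices ∃ f : (Fin 7 → K) →ₗ[K] (Fin 2 → K), Function.Surjective f ∧
      ∀ v, v ∈ trilinRad χ u ↔ f v = 0 by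
    obtain ⟨f, hf, hS⟩ := this
    have := finrank_add_eq_of_surjective f hf hS
    omega
  let π (i : Fin 7) : (Fin 7 → K) →ₗ[K] K := LinearMap.proj i
  by_cases hb : u 1 = 0
  · have ha : u 0 = 0 := by simpa [hb] using hd
    have hc : u 2 ≠ 0 := by
      intro hc
      refine hu (funext fun i => ?_)
      fin_cases i <;> assumption
    refine ⟨LinearMap.pi ![π 5, π 6], fun y => ⟨![0, 0, 0, 0, 0, y 0, y 1], ?_⟩, fun v => ?_⟩
    · ext i
      fin_cases i <;> simp [π]
    · rw [mem_trilinRad_iff hχ, funext_iff, Fin.forall_fin_two]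
      simp [π, *]
      tauto
  · refine ⟨LinearMap.pi ![u 1 • π 4 + u 0 • π 5, u 1 • π 3 - u 0 • π 6],
      fun y => ⟨![0, 0, 0, y 1 / u 1, y 0 / u 1, 0, 0], ?_⟩, fun v => ?_⟩
    · ext i
      fin_cases i <;> simp [π] <;> field_simp
    · rw [mem_trilinRad_iff hχ, funext_iff, Fin.forall_fin_two]
      simp [π, hp, hq, hr, hs]
      grind

end Form

/-- for `χ = [146] + [157] + [245] + [367]` on `K^7`:
(i) a nonzero `u` is a pole iff `u₅u₇ + u₄u₆ = 0`;
(ii) `dim Rad_χ(u) = 5` iff `u ≠ 0`, `u₄ = u₅ = u₆ = u₇ = 0` and `u₁² − u₂u₃ = 0`. -/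
theorem stmt17 (K : Type*) [Field K]
    (χ : AlternatingMap K (Fin 7 → K) K (Fin 3))
    (hχ : χ = trip 0 3 5 + trip 0 4 6 + trip 1 3 4 + trip 2 5 6) :
    (∀ u : Fin 7 → K, u ≠ 0 →
      (2 ≤ Module.finrank K (trilinRad χ u) ↔ u 4 * u 6 + u 3 * u 5 = 0)) ∧
    (∀ u : Fin 7 → K,
      (Module.finrank K (trilinRad χ u) = 5 ↔
        (u ≠ 0 ∧ u 3 = 0 ∧ u 4 = 0 ∧ u 5 = 0 ∧ u 6 = 0 ∧
          u 0 ^ 2 - u 1 * u 2 = 0))) := by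
  refine ⟨fun u hu => ⟨fun h => ?_, two_le_finrank_trilinRad hχ hu⟩, fun u => ⟨fun h => ?_, ?_⟩⟩
  · by_contra hd
    have := finrank_trilinRad_le_one hχ hd
    omega
  · have hu : u ≠ 0 := by
      rintro rfl
      have htop : trilinRad χ 0 = ⊤ := by
        rw [eq_top_iff]
        intro v _
        simp [mem_trilinRad_iff hχ]
      rw [htop, finrank_top] at h
      simp at h
    by_contra hcon
    have := finrank_trilinRad_le_four hχ (u := u) (by tauto)
    omega
  · rintro ⟨hu, hp, hq, hr, hs, hd⟩
    exact finrank_trilinRad_eq_five hχ hu hp hq hr hs hd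
end

section
/- Let K be a field, V = K^7, and χ := [123] + [456] + [147] + [257] + [367]. Then: (i) for every nonzero u ∈ V, dim Rad_χ(u) = 3 if u_7² − u_3·u_6 − u_2·u_5 − u_1·u_4 = 0 and dim Rad_χ(u) = 1 otherwise; in particular the poles of χ are exactly the nonzero points of this nonsingular quadric and every pole has degree 2; (ii) writing p_{ij} := x_i·y_j − x_j·y_i for x, y ∈ V, a 2-dimensional subspace ℓ = span{x, y} of V lies in the upper radical R↑(χ) if and only if p_{23} + p_{47} = 0, p_{57} − p_{13} = 0, p_{12} + p_{67} = 0, p_{56} − p_{17} = 0, p_{27} + p_{46} = 0, p_{45} − p_{37} = 0, and p_{14} + p_{25} + p_{36} = 0 (the equations of the split Cayley hexagon). -/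
open Module

/-- The form `[123] + [456] + [147] + [257] + [367]` on `K^7`. -/
noncomputable def hexForm (K : Type*) [Field K] : AlternatingMap K (Fin 7 → K) K (Fin 3) :=
  trip 0 1 2 + trip 3 4 5 + trip 0 3 6 + trip 1 4 6 + trip 2 5 6

/-- The Plücker equations of the split Cayley hexagon for the line through `x` and `y`. -/
def HexEquations {K : Type*} [Field K] (x y : Fin 7 → K) : Prop :=
  (x 1 * y 2 - x 2 * y 1) + (x 3 * y 6 - x 6 * y 3) = 0 ∧
  (x 4 * y 6 - x 6 * y 4) - (x 0 * y 2 - x 2 * y 0) = 0 ∧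
  (x 0 * y 1 - x 1 * y 0) + (x 5 * y 6 - x 6 * y 5) = 0 ∧
  (x 4 * y 5 - x 5 * y 4) - (x 0 * y 6 - x 6 * y 0) = 0 ∧
  (x 1 * y 6 - x 6 * y 1) + (x 3 * y 5 - x 5 * y 3) = 0 ∧
  (x 3 * y 4 - x 4 * y 3) - (x 2 * y 6 - x 6 * y 2) = 0 ∧
  (x 0 * y 3 - x 3 * y 0) + (x 1 * y 4 - x 4 * y 1) + (x 2 * y 5 - x 5 * y 2) = 0

section

variable {K : Type*} [Field K]

lemma hexForm_apply (u x y : Fin 7 → K) :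
    hexForm K ![u, x, y] =
      u 0 * ((x 1 * y 2 - x 2 * y 1) + (x 3 * y 6 - x 6 * y 3)) +
      u 1 * ((x 4 * y 6 - x 6 * y 4) - (x 0 * y 2 - x 2 * y 0)) +
      u 2 * ((x 0 * y 1 - x 1 * y 0) + (x 5 * y 6 - x 6 * y 5)) +
      u 3 * ((x 4 * y 5 - x 5 * y 4) - (x 0 * y 6 - x 6 * y 0)) -
      u 4 * ((x 1 * y 6 - x 6 * y 1) + (x 3 * y 5 - x 5 * y 3)) +
      u 5 * ((x 3 * y 4 - x 4 * y 3) - (x 2 * y 6 - x 6 * y 2)) +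
      u 6 * ((x 0 * y 3 - x 3 * y 0) + (x 1 * y 4 - x 4 * y 1) +
        (x 2 * y 5 - x 5 * y 2)) := by
  simp only [hexForm, AlternatingMap.add_apply, trip_apply]
  ring

lemma forall_hexForm_eq_zero_iff (x y : Fin 7 → K) :
    (∀ u, hexForm K ![u, x, y] = 0) ↔ HexEquations x y := by
  simp only [hexForm_apply]
  constructor
  · intro h
    refine ⟨?_, ?_, ?_, ?_, ?_, ?_, ?_⟩
    · simpa using h (Pi.single 0 1)
    · simpa using h (Pi.single 1 1)
    · simpa using h (Pi.single 2 1)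
    · simpa using h (Pi.single 3 1)
    · simpa [-neg_add_rev] using h (Pi.single 4 (-1))
    · simpa using h (Pi.single 5 1)
    · simpa using h (Pi.single 6 1)
  · rintro ⟨h0, h1, h2, h3, h4, h5, h6⟩ u
    rw [h0, h1, h2, h3, h4, h5, h6]
    ring

lemma mem_trilinRad_hexForm (u v : Fin 7 → K) :
    v ∈ trilinRad (hexForm K) u ↔ HexEquations u v := by
  rw [← forall_hexForm_eq_zero_iff]
  refine forall_congr' fun x => ?_
  rw [show hexForm K ![u, v, x] = hexForm K ![x, u, v] by simp only [hexForm_apply]; ring]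

lemma HexEquations.self (u : Fin 7 → K) : HexEquations u u := by
  refine ⟨?_, ?_, ?_, ?_, ?_, ?_, ?_⟩ <;> ring

/-- The quadric supporting the split Cayley hexagon. -/
def hexQuadric (u : Fin 7 → K) : K :=
  u 6 ^ 2 - u 2 * u 5 - u 1 * u 4 - u 0 * u 3

lemma HexEquations.quadric_smul {u v : Fin 7 → K} (h : HexEquations u v) :
    hexQuadric u • v = (u 6 * v 6 - (u 3 * v 0 + u 4 * v 1 + u 5 * v 2)) • u := by
  obtain ⟨h0, h1, h2, h3, h4, h5, h6⟩ := h
  funext i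
  simp only [Pi.smul_apply, smul_eq_mul, hexQuadric]
  fin_cases i <;> simp only [Fin.zero_eta, Fin.mk_one, Fin.reduceFinMk]
  · linear_combination u 6 * h3 + u 4 * h2 - u 5 * h1
  · linear_combination -u 6 * h4 - u 3 * h2 + u 5 * h0
  · linear_combination u 6 * h5 + u 3 * h1 - u 4 * h0
  · linear_combination -u 6 * h0 + u 1 * h5 + u 2 * h4 - u 3 * h6
  · linear_combination -u 6 * h1 - u 0 * h5 + u 2 * h3 - u 4 * h6
  · linear_combination -u 6 * h2 - u 0 * h4 - u 1 * h3 - u 5 * h6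
  · linear_combination u 3 * h3 - u 4 * h4 + u 5 * h5

lemma finrank_trilinRad_hexForm_of_quadric_ne_zero {u : Fin 7 → K} (h : hexQuadric u ≠ 0) :
    finrank K (trilinRad (hexForm K) u) = 1 := by
  have hu : u ≠ 0 := by
    rintro rfl
    simp [hexQuadric] at h
  have hspan : trilinRad (hexForm K) u = Submodule.span K {u} := by
    ext v
    rw [mem_trilinRad_hexForm, Submodule.mem_span_singleton]
    constructor
    · intro hv
      exact ⟨(hexQuadric u)⁻¹ * (u 6 * v 6 - (u 3 * v 0 + u 4 * v 1 + u 5 * v 2)), by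
        rw [mul_smul, ← hv.quadric_smul, inv_smul_smul₀ h]⟩
    · rintro ⟨c, rfl⟩
      exact (mem_trilinRad_hexForm _ _).1
        (Submodule.smul_mem _ c ((mem_trilinRad_hexForm _ _).2 (.self u)))
  rw [hspan, finrank_span_singleton hu]

lemma finrank_trilinRad_hexForm_of_apply_zero_ne_zero {u : Fin 7 → K} (h : hexQuadric u = 0)
    (h0 : u 0 ≠ 0) : finrank K (trilinRad (hexForm K) u) = 3 := by
  let f : trilinRad (hexForm K) u →ₗ[K] (Fin 3 → K) :=
    (LinearMap.funLeft K K ![0, 4, 5]).comp (trilinRad (hexForm K) u).subtype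
  have hf : Function.Bijective f := by
    constructor
    · rw [injective_iff_map_eq_zero]
      rintro ⟨v, hv⟩ hfv
      have v0 : v 0 = 0 := congrFun hfv 0
      have v4 : v 4 = 0 := congrFun hfv 1
      have v5 : v 5 = 0 := congrFun hfv 2
      obtain ⟨e0, e1, e2, e3, e4, e5, e6⟩ := (mem_trilinRad_hexForm u v).1 hv
      have v6 : v 6 = 0 := by simpa [v0, v4, v5, h0] using e3
      have v2 : v 2 = 0 := by simpa [v0, v4, v5, v6, h0] using e1
      have v1 : v 1 = 0 := by simpa [v0, v4, v5, v6, h0] using e2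
      have v3 : v 3 = 0 := by simpa [v0, v1, v2, v4, v5, h0] using e6
      ext i
      fin_cases i <;> assumption
    · intro w
      obtain ⟨s, hs⟩ : ∃ s, s = (u 4 * w 2 - u 5 * w 1 + u 6 * w 0) / u 0 := ⟨_, rfl⟩
      obtain ⟨c, hc⟩ : ∃ c, c = (u 1 * w 0 - u 5 * s + u 6 * w 2) / u 0 := ⟨_, rfl⟩
      obtain ⟨d, hd⟩ : ∃ d, d = (u 4 * s - u 6 * w 1 + u 2 * w 0) / u 0 := ⟨_, rfl⟩
      obtain ⟨b, hb⟩ : ∃ b, b =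
          (u 3 * w 0 - (u 1 * w 1 - u 4 * c) - (u 2 * w 2 - u 5 * d)) / u 0 := ⟨_, rfl⟩
      rw [eq_div_iff h0] at hs hc hd hb
      unfold hexQuadric at h
      have hm : u 6 * s - u 3 * w 0 - u 4 * c - u 5 * d = 0 := mul_left_cancel₀ h0 <| by
        linear_combination u 6 * hs - u 4 * hc - u 5 * hd + w 0 * h
      have e4 : (u 1 * s - u 6 * c) + (u 3 * w 2 - u 5 * b) = 0 := mul_left_cancel₀ h0 <| by
        linear_combination u 1 * hs - u 6 * hc - u 5 * hb - w 2 * h + u 5 * hm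
      have e5 : (u 3 * w 1 - u 4 * b) - (u 2 * s - u 6 * d) = 0 := mul_left_cancel₀ h0 <| by
        linear_combination -u 4 * hb - u 2 * hs + u 6 * hd - w 1 * h + u 4 * hm
      have hv : HexEquations u ![w 0, c, d, b, w 1, w 2, s] := by
        refine ⟨?_, ?_, ?_, ?_, e4, e5, ?_⟩ <;> simp only [Matrix.cons_val]
        · refine mul_left_cancel₀ h0 ?_
          linear_combination u 1 * hd - u 2 * hc - u 6 * hb + u 3 * hs + u 4 * e4 - u 5 * e5
        · linear_combination -hd
        · linear_combination hc
        · linear_combination -hs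
        · linear_combination hb
      refine ⟨⟨_, (mem_trilinRad_hexForm _ _).2 hv⟩, ?_⟩
      ext i
      fin_cases i <;> rfl
  rw [(LinearEquiv.ofBijective f hf).finrank_eq, finrank_fin_fun]

lemma finrank_trilinRad_map {V : Type*} [AddCommGroup V] [Module K V]
    (χ : AlternatingMap K V K (Fin 3)) (e : V ≃ₗ[K] V)
    (he : ∀ x y z, χ ![e x, e y, e z] = χ ![x, y, z]) (u : V) :
    finrank K (trilinRad χ (e u)) = finrank K (trilinRad χ u) := by
  have hmap : trilinRad χ (e u) = (trilinRad χ u).map e.toLinearMap := by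
    ext v
    obtain ⟨v, rfl⟩ := e.surjective v
    rw [Submodule.mem_map_equiv, e.symm_apply_apply]
    change (∀ x, χ ![e u, e v, x] = 0) ↔ ∀ x, χ ![u, v, x] = 0
    rw [e.surjective.forall]
    simp only [he]
  rw [hmap, LinearEquiv.finrank_map_eq]

/-- The symmetry of `hexForm` permuting the coordinates in each of the two triples cyclically. -/
def hexRotate (K : Type*) [Field K] : (Fin 7 → K) ≃ₗ[K] (Fin 7 → K) where
  toFun v := ![v 1, v 2, v 0, v 4, v 5, v 3, v 6]
  invFun v := ![v 2, v 0, v 1, v 5, v 3, v 4, v 6]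
  map_add' v w := by ext i; fin_cases i <;> rfl
  map_smul' c v := by ext i; fin_cases i <;> rfl
  left_inv v := by ext i; fin_cases i <;> rfl
  right_inv v := by ext i; fin_cases i <;> rfl

/-- The symmetry of `hexForm` exchanging the two triples of coordinates. -/
def hexSwap (K : Type*) [Field K] : (Fin 7 → K) ≃ₗ[K] (Fin 7 → K) where
  toFun v := ![v 3, v 4, v 5, v 0, v 1, v 2, -v 6]
  invFun v := ![v 3, v 4, v 5, v 0, v 1, v 2, -v 6]
  map_add' v w := by ext i; fin_cases i <;> simp [add_comm]
  map_smul' c v := by ext i; fin_cases i <;> simp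
  left_inv v := by ext i; fin_cases i <;> simp
  right_inv v := by ext i; fin_cases i <;> simp

lemma hexRotate_apply (v : Fin 7 → K) :
    hexRotate K v = ![v 1, v 2, v 0, v 4, v 5, v 3, v 6] := rfl

lemma hexSwap_apply (v : Fin 7 → K) :
    hexSwap K v = ![v 3, v 4, v 5, v 0, v 1, v 2, -v 6] := rfl

lemma finrank_trilinRad_hexRotate (u : Fin 7 → K) :
    finrank K (trilinRad (hexForm K) (hexRotate K u)) =
      finrank K (trilinRad (hexForm K) u) := by
  refine finrank_trilinRad_map _ _ (fun x y z => ?_) u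
  simp only [hexForm_apply, hexRotate_apply, Matrix.cons_val]
  ring

lemma finrank_trilinRad_hexSwap (u : Fin 7 → K) :
    finrank K (trilinRad (hexForm K) (hexSwap K u)) =
      finrank K (trilinRad (hexForm K) u) := by
  refine finrank_trilinRad_map _ _ (fun x y z => ?_) u
  simp only [hexForm_apply, hexSwap_apply, Matrix.cons_val]
  ring

lemma hexQuadric_hexRotate (u : Fin 7 → K) : hexQuadric (hexRotate K u) = hexQuadric u := by
  simp only [hexQuadric, hexRotate_apply, Matrix.cons_val]
  ring

lemma hexQuadric_hexSwap (u : Fin 7 → K) : hexQuadric (hexSwap K u) = hexQuadric u := by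
  simp only [hexQuadric, hexSwap_apply, Matrix.cons_val]
  ring

lemma finrank_trilinRad_hexForm_of_first_triple {u : Fin 7 → K} (h : hexQuadric u = 0)
    (hu : u 0 ≠ 0 ∨ u 1 ≠ 0 ∨ u 2 ≠ 0) : finrank K (trilinRad (hexForm K) u) = 3 := by
  rcases hu with hu | hu | hu
  · exact finrank_trilinRad_hexForm_of_apply_zero_ne_zero h hu
  · rw [← finrank_trilinRad_hexRotate]
    exact finrank_trilinRad_hexForm_of_apply_zero_ne_zero (by rwa [hexQuadric_hexRotate]) hu
  · rw [← finrank_trilinRad_hexRotate, ← finrank_trilinRad_hexRotate]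
    exact finrank_trilinRad_hexForm_of_apply_zero_ne_zero
      (by rwa [hexQuadric_hexRotate, hexQuadric_hexRotate]) hu

lemma finrank_trilinRad_hexForm_of_quadric_eq_zero {u : Fin 7 → K} (hu : u ≠ 0)
    (h : hexQuadric u = 0) : finrank K (trilinRad (hexForm K) u) = 3 := by
  by_cases ha : u 0 ≠ 0 ∨ u 1 ≠ 0 ∨ u 2 ≠ 0
  · exact finrank_trilinRad_hexForm_of_first_triple h ha
  by_cases hb : u 3 ≠ 0 ∨ u 4 ≠ 0 ∨ u 5 ≠ 0
  · rw [← finrank_trilinRad_hexSwap]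
    exact finrank_trilinRad_hexForm_of_first_triple (by rwa [hexQuadric_hexSwap]) hb
  push Not at ha hb
  obtain ⟨u0, u1, u2⟩ := ha
  obtain ⟨u3, u4, u5⟩ := hb
  have u6 : u 6 = 0 := by simpa [hexQuadric, u0, u1, u2] using h
  refine absurd ?_ hu
  ext i
  fin_cases i <;> assumption

lemma HexEquations.hexForm_eq_zero_of_mem_span {x y a b : Fin 7 → K} (h : HexEquations x y)
    (ha : a ∈ Submodule.span K {x, y}) (hb : b ∈ Submodule.span K {x, y}) (u : Fin 7 → K) :
    hexForm K ![u, a, b] = 0 := by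
  obtain ⟨α, β, rfl⟩ := Submodule.mem_span_pair.1 ha
  obtain ⟨γ, δ, rfl⟩ := Submodule.mem_span_pair.1 hb
  have hdet : hexForm K ![u, α • x + β • y, γ • x + δ • y] =
      (α * δ - β * γ) * hexForm K ![u, x, y] := by
    simp only [hexForm_apply, Pi.add_apply, Pi.smul_apply, smul_eq_mul]
    ring
  rw [hdet, (forall_hexForm_eq_zero_iff x y).2 h u, mul_zero]

end

/-- for `χ = [123] + [456] + [147] + [257] + [367]` on `K^7`:
(i) `dim Rad_χ(u) = 3` for nonzero `u` on the quadric `u₇² − u₃u₆ − u₂u₅ − u₁u₄ = 0` and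
`dim Rad_χ(u) = 1` elsewhere (so the poles are the nonzero points of the quadric, all of
degree 2);
(ii) a 2-dimensional subspace `span{x, y}` lies in the upper radical iff the Plücker
coordinates `p_{ij} = x_i y_j − x_j y_i` satisfy the equations of the split Cayley
hexagon. -/
theorem stmt18 (K : Type*) [Field K]
    (χ : AlternatingMap K (Fin 7 → K) K (Fin 3))
    (hχ : χ = trip 0 1 2 + trip 3 4 5 + trip 0 3 6 + trip 1 4 6 + trip 2 5 6) :
    (∀ u : Fin 7 → K, u ≠ 0 →
      ((u 6 ^ 2 - u 2 * u 5 - u 1 * u 4 - u 0 * u 3 = 0 →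
          Module.finrank K (trilinRad χ u) = 3) ∧
        (u 6 ^ 2 - u 2 * u 5 - u 1 * u 4 - u 0 * u 3 ≠ 0 →
          Module.finrank K (trilinRad χ u) = 1))) ∧
    (∀ x y : Fin 7 → K,
      Module.finrank K (Submodule.span K ({x, y} : Set (Fin 7 → K))) = 2 →
      ((∀ u : Fin 7 → K, ∀ a ∈ Submodule.span K ({x, y} : Set (Fin 7 → K)),
          ∀ b ∈ Submodule.span K ({x, y} : Set (Fin 7 → K)), χ ![u, a, b] = 0) ↔
        ((x 1 * y 2 - x 2 * y 1) + (x 3 * y 6 - x 6 * y 3) = 0 ∧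
          (x 4 * y 6 - x 6 * y 4) - (x 0 * y 2 - x 2 * y 0) = 0 ∧
          (x 0 * y 1 - x 1 * y 0) + (x 5 * y 6 - x 6 * y 5) = 0 ∧
          (x 4 * y 5 - x 5 * y 4) - (x 0 * y 6 - x 6 * y 0) = 0 ∧
          (x 1 * y 6 - x 6 * y 1) + (x 3 * y 5 - x 5 * y 3) = 0 ∧
          (x 3 * y 4 - x 4 * y 3) - (x 2 * y 6 - x 6 * y 2) = 0 ∧
          (x 0 * y 3 - x 3 * y 0) + (x 1 * y 4 - x 4 * y 1) +
            (x 2 * y 5 - x 5 * y 2) = 0))) := by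
  obtain rfl : χ = hexForm K := hχ
  refine ⟨fun u hu => ⟨finrank_trilinRad_hexForm_of_quadric_eq_zero hu,
    finrank_trilinRad_hexForm_of_quadric_ne_zero⟩, fun x y _ => ⟨fun h => ?_, fun h u a ha b hb =>
      HexEquations.hexForm_eq_zero_of_mem_span h ha hb u⟩⟩
  exact (forall_hexForm_eq_zero_iff x y).1 fun u =>
    h u x (Submodule.subset_span (by simp)) y (Submodule.subset_span (by simp))
end
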